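/- arXiv:1503.06607 — 2 statements merged into one kernel-verified Lean document; each statement's English description precedes it below -/
import Mathlib

section
/- For every (x,y) ∈ D(π/4) and every (a,b,c) ∈ ℝ³, ‖DP_{a,b,c}(x,y)‖ ≤ Ψ(x,y)·‖(a,b,c)‖. -/
open Real Set

noncomputable section

/-- The sector D(π/4): points (x,y) with 0 ≤ y ≤ x and x² + y² ≤ 1. -/
def sector : Set (ℝ × ℝ) := {p | 0 ≤ p.2 ∧ p.2 ≤ p.1 ∧ p.1 ^ 2 + p.2 ^ 2 ≤ 1}

/-- The supremum norm of the 2-homogeneous polynomial a·x² + b·y² + c·x·y over the sector. -/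
def secNorm (a b c : ℝ) : ℝ :=
  sSup ((fun p : ℝ × ℝ => |a * p.1 ^ 2 + b * p.2 ^ 2 + c * p.1 * p.2|) '' sector)

/-- The sup over the sector of the differential of P_{a,b,c} at (x,y). -/
def diffNorm (a b c x y : ℝ) : ℝ :=
  sSup ((fun q : ℝ × ℝ => |(2 * a * x + c * y) * q.1 + (2 * b * y + c * x) * q.2|) '' sector)

/-- The optimal Bernstein factor Ψ for the sector-sup norm of the differential. -/
def Psi (x y : ℝ) : ℝ :=
  if y < (2 * Real.sqrt 2 - 1) / 7 * x then
    Real.sqrt 2 * ((1 + 2 * Real.sqrt 2) * x - (3 + 2 * Real.sqrt 2) * y)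
  else if y < (Real.sqrt 2 - 1) * x then
    Real.sqrt 2 * (x ^ 2 + 3 * y ^ 2) / (2 * y)
  else if y < (2 - Real.sqrt 2) * x then
    2 * (x + y ^ 2 / (x - y))
  else
    4 * (1 + Real.sqrt 2) * y - 2 * x

lemma bddAbove_secNorm (a b c : ℝ) :
    BddAbove ((fun p : ℝ × ℝ => |a * p.1 ^ 2 + b * p.2 ^ 2 + c * p.1 * p.2|) '' sector) := by
  refine ⟨|a| + |b| + |c|, ?_⟩
  rintro _ ⟨⟨u, v⟩, ⟨hv, hvu, huv⟩, rfl⟩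
  simp only at hv hvu huv ⊢
  have hu : |u ^ 2| ≤ 1 := by rw [abs_of_nonneg (sq_nonneg u)]; nlinarith [sq_nonneg v]
  have hv' : |v ^ 2| ≤ 1 := by rw [abs_of_nonneg (sq_nonneg v)]; nlinarith [sq_nonneg u]
  have huv' : |u * v| ≤ 1 := by
    rw [abs_of_nonneg (mul_nonneg (hv.trans hvu) hv)]; nlinarith [sq_nonneg (u - v)]
  calc |a * u ^ 2 + b * v ^ 2 + c * u * v|
      ≤ |a * u ^ 2| + |b * v ^ 2| + |c * u * v| := abs_add_three _ _ _
    _ = |a| * |u ^ 2| + |b| * |v ^ 2| + |c| * |u * v| := by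
        rw [mul_assoc c, abs_mul a, abs_mul b, abs_mul c]
    _ ≤ |a| + |b| + |c| := by
        gcongr <;> exact mul_le_of_le_one_right (abs_nonneg _) ‹_›

lemma secNorm_nonneg (a b c : ℝ) : 0 ≤ secNorm a b c :=
  Real.sSup_nonneg (by rintro _ ⟨p, -, rfl⟩; exact abs_nonneg _)

/-- Homogeneous form of the bound given by `secNorm`, on the whole cone spanned by the sector. -/
lemma abs_le_secNorm_mul (a b c : ℝ) {u v : ℝ} (hv : 0 ≤ v) (hvu : v ≤ u) :
    |a * u ^ 2 + b * v ^ 2 + c * u * v| ≤ secNorm a b c * (u ^ 2 + v ^ 2) := by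
  rcases (hv.trans hvu).eq_or_lt with hu | hu
  · obtain rfl : v = 0 := by linarith
    simp [← hu]
  have hr : 0 < u ^ 2 + v ^ 2 := by positivity
  set r := √(u ^ 2 + v ^ 2)
  have hr0 : 0 < r := Real.sqrt_pos.2 hr
  have hrr : r ^ 2 = u ^ 2 + v ^ 2 := Real.sq_sqrt hr.le
  have hmem : (u / r, v / r) ∈ sector := by
    refine ⟨by positivity, by simp only; gcongr, ?_⟩
    simp only [div_pow, hrr]
    rw [← add_div, div_self hr.ne']
  have h := le_csSup (bddAbove_secNorm a b c) (mem_image_of_mem _ hmem)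
  simp only at h
  have he : a * (u / r) ^ 2 + b * (v / r) ^ 2 + c * (u / r) * (v / r)
      = (a * u ^ 2 + b * v ^ 2 + c * u * v) / r ^ 2 := by
    field_simp
  rw [he, abs_div, abs_of_pos (pow_pos hr0 2), div_le_iff₀ (pow_pos hr0 2), hrr] at h
  exact h

/-- A linear form on the sector is controlled by its values at the two extreme directions, unless
its gradient `(g, h)` lies (up to sign) in the cone, where its value `e` at `(x, y)` controls it. -/
lemma linear_le_of_extreme {g h x y P M u v : ℝ} (hx : 0 < x) (hM : 0 ≤ M) (hP : 0 ≤ P)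
    (hg : |g| ≤ P * M) (hgh : |g + h| ≤ √2 * (P * M))
    (he : g * x + h * y ≤ 2 * (x ^ 2 + y ^ 2) * M)
    (h₁ : 2 * (x ^ 2 + y ^ 2) ≤ P * x) (h₂ : 2 * √2 * (x ^ 2 + y ^ 2) ≤ P * (x + y))
    (hv : 0 ≤ v) (hvu : v ≤ u) (huv : u ^ 2 + v ^ 2 ≤ 1) :
    g * u + h * v ≤ P * M := by
  have hs : √2 ^ 2 = 2 := Real.sq_sqrt (by norm_num)
  have hs0 : 0 < √2 := by positivity
  have hu1 : u ≤ 1 := by nlinarith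
  have hPM := mul_nonneg hP hM
  have huv2 : u + v ≤ √2 := by
    apply le_of_sq_le_sq _ hs0.le
    nlinarith [sq_nonneg (u - v)]
  have hv2 : √2 * v ≤ 1 := by nlinarith
  obtain ⟨hg1, hg2⟩ := abs_le.1 hg
  obtain ⟨hgh1, hgh2⟩ := abs_le.1 hgh
  rcases le_total h g with hle | hle
  · rcases le_total 0 h with hh | hh
    · have hd : 0 ≤ g - h := sub_nonneg.2 hle
      have key : (g - h) + √2 * h ≤ P * M := by
        have hr : 0 < 2 * (x ^ 2 + y ^ 2) := by positivity
        refine le_of_mul_le_mul_right ?_ hr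
        nlinarith [mul_le_mul_of_nonneg_left h₁ hd, mul_le_mul_of_nonneg_left h₂ hh,
          mul_le_mul_of_nonneg_left he hP]
      nlinarith [mul_le_mul_of_nonneg_left hu1 hd, mul_le_mul_of_nonneg_left huv2 hh]
    · have : g * u ≤ P * M := by
        rcases le_total 0 g with h0 | h0 <;> nlinarith
      nlinarith
  · rcases le_total 0 (g + h) with hh | hh
    · have h3 : g * u + h * v ≤ (g + h) * (u + v) / 2 := by
        nlinarith [mul_nonneg (sub_nonneg.2 hle) (sub_nonneg.2 hvu)]
      nlinarith [mul_le_mul_of_nonneg_left huv2 hh, mul_le_mul_of_nonneg_left hgh2 hs0.le]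
    · nlinarith [mul_nonneg (sub_nonneg.2 hle) (sub_nonneg.2 hvu)]

lemma abs_partial_le_two_points {a b c M x y : ℝ}
    (H : ∀ u v : ℝ, 0 ≤ v → v ≤ u → |a * u ^ 2 + b * v ^ 2 + c * u * v| ≤ M * (u ^ 2 + v ^ 2))
    (hy : 0 ≤ y) (hyx : y ≤ x) :
    (x - y) * |2 * a * x + c * y| ≤ 2 * (x ^ 2 - x * y + y ^ 2) * M := by
  have h1 := abs_le.1 (H (2 * x - y) y hy (by linarith))
  have h2 := abs_le.1 (H y y hy le_rfl)
  rw [← abs_of_nonneg (sub_nonneg.2 hyx), ← abs_mul, abs_le]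
  constructor <;> linarith

lemma abs_diag_le_two_points {a b c M x y : ℝ}
    (H : ∀ u v : ℝ, 0 ≤ v → v ≤ u → |a * u ^ 2 + b * v ^ 2 + c * u * v| ≤ M * (u ^ 2 + v ^ 2))
    (hy : 0 ≤ y) (hyx : y ≤ x) :
    y * |(2 * a * x + c * y) + (2 * b * y + c * x)| ≤ (x ^ 2 + 3 * y ^ 2) * M := by
  have h1 := abs_le.1 (H (x + y) (2 * y) (by linarith) (by linarith))
  have h2 := abs_le.1 (H (x - y) 0 le_rfl (by linarith))
  nth_rewrite 1 [← abs_of_nonneg hy]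
  rw [← abs_mul, abs_le]
  constructor <;> linarith

lemma abs_partial_le_three_points {a b c M x y : ℝ}
    (H : ∀ u v : ℝ, 0 ≤ v → v ≤ u → |a * u ^ 2 + b * v ^ 2 + c * u * v| ≤ M * (u ^ 2 + v ^ 2))
    (hy : 0 ≤ y) (hyx : 2 * x ≤ (2 + √2) * y) :
    |2 * a * x + c * y| ≤ (4 * (1 + √2) * y - 2 * x) * M := by
  have hs : √2 ^ 2 = 2 := Real.sq_sqrt (by norm_num)
  have hs0 : 0 ≤ √2 := Real.sqrt_nonneg 2
  obtain ⟨h1, h1'⟩ := abs_le.1 (H 1 0 le_rfl zero_le_one)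
  obtain ⟨h2, h2'⟩ := abs_le.1 (H (√2 + 1) 1 zero_le_one (by linarith))
  obtain ⟨h3, h3'⟩ := abs_le.1 (H 1 1 zero_le_one le_rfl)
  have hα := sub_nonneg.2 hyx
  have hβ : 0 ≤ √2 / 2 * y := by positivity
  generalize √2 = s at *
  have e : 2 * a * x + c * y = -((2 + s) * y - 2 * x) * (a * 1 ^ 2 + b * 0 ^ 2 + c * 1 * 0)
      + s / 2 * y * (a * (s + 1) ^ 2 + b * 1 ^ 2 + c * (s + 1) * 1)
      - s / 2 * y * (a * 1 ^ 2 + b * 1 ^ 2 + c * 1 * 1) := by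
    linear_combination (-(s * a * y / 2) - a * y - c * y / 2) * hs
  have e' : (4 * (1 + s) * y - 2 * x) * M = ((2 + s) * y - 2 * x) * (M * (1 ^ 2 + 0 ^ 2))
      + s / 2 * y * (M * ((s + 1) ^ 2 + 1 ^ 2)) + s / 2 * y * (M * (1 ^ 2 + 1 ^ 2)) := by
    linear_combination (-(s * y * M / 2) - y * M) * hs
  rw [e, e', abs_le]
  constructor
  · linarith [mul_le_mul_of_nonneg_left h1' hα, mul_le_mul_of_nonneg_left h2 hβ,
      mul_le_mul_of_nonneg_left h3' hβ]
  · linarith [mul_le_mul_of_nonneg_left h1 hα, mul_le_mul_of_nonneg_left h2' hβ,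
      mul_le_mul_of_nonneg_left h3 hβ]

lemma abs_diag_le_three_points {a b c M x y : ℝ}
    (H : ∀ u v : ℝ, 0 ≤ v → v ≤ u → |a * u ^ 2 + b * v ^ 2 + c * u * v| ≤ M * (u ^ 2 + v ^ 2))
    (hyx : y ≤ x) (h : 4 * y ≤ √2 * (x - y)) :
    |(2 * a * x + c * y) + (2 * b * y + c * x)|
      ≤ 2 * ((1 + 2 * √2) * x - (3 + 2 * √2) * y) * M := by
  have hs : √2 ^ 2 = 2 := Real.sq_sqrt (by norm_num)
  have hs0 : 0 ≤ √2 := Real.sqrt_nonneg 2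
  obtain ⟨h1, h1'⟩ := abs_le.1 (H 1 0 le_rfl zero_le_one)
  obtain ⟨h2, h2'⟩ := abs_le.1 (H (√2 + 1) 1 zero_le_one (by linarith))
  obtain ⟨h3, h3'⟩ := abs_le.1 (H 1 1 zero_le_one le_rfl)
  have hα : 0 ≤ √2 * (x - y) := mul_nonneg hs0 (sub_nonneg.2 hyx)
  have hγ := sub_nonneg.2 h
  generalize √2 = s at *
  have e : (2 * a * x + c * y) + (2 * b * y + c * x)
      = -(s * (x - y)) * (a * 1 ^ 2 + b * 0 ^ 2 + c * 1 * 0)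
      + s * (x - y) / 2 * (a * (s + 1) ^ 2 + b * 1 ^ 2 + c * (s + 1) * 1)
      - (s * (x - y) - 4 * y) / 2 * (a * 1 ^ 2 + b * 1 ^ 2 + c * 1 * 1) := by
    linear_combination (-(s * (x - y) * a / 2) - (x - y) * a - (x - y) * c / 2) * hs
  have e' : 2 * ((1 + 2 * s) * x - (3 + 2 * s) * y) * M = s * (x - y) * (M * (1 ^ 2 + 0 ^ 2))
      + s * (x - y) / 2 * (M * ((s + 1) ^ 2 + 1 ^ 2))
      + (s * (x - y) - 4 * y) / 2 * (M * (1 ^ 2 + 1 ^ 2)) := by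
    linear_combination (-(s * (x - y) * M / 2) - (x - y) * M) * hs
  rw [e, e', abs_le]
  constructor
  · linarith [mul_le_mul_of_nonneg_left h1' hα, mul_le_mul_of_nonneg_left h2 hα,
      mul_le_mul_of_nonneg_left h3' hγ]
  · linarith [mul_le_mul_of_nonneg_left h1 hα, mul_le_mul_of_nonneg_left h2' hα,
      mul_le_mul_of_nonneg_left h3 hγ]

/-- The factorization comparing the two middle branches of `Psi`. -/
lemma middle_branches_factor (x y : ℝ) :
    √2 * (x ^ 2 + 3 * y ^ 2) * (x - y) - 4 * y * (x ^ 2 - x * y + y ^ 2)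
      = ((√2 - 1) * x - y)
        * ((2 + √2) * x ^ 2 - 2 * (√2 + 1) * x * y + (3 * √2 + 4) * y ^ 2) := by
  have hs : √2 ^ 2 = 2 := Real.sq_sqrt (by norm_num)
  generalize √2 = s at *
  linear_combination (-x ^ 3 + 2 * x ^ 2 * y - 3 * x * y ^ 2) * hs

lemma middle_factor_nonneg (x y : ℝ) :
    0 ≤ (2 + √2) * x ^ 2 - 2 * (√2 + 1) * x * y + (3 * √2 + 4) * y ^ 2 := by
  have hs0 : 0 ≤ √2 := Real.sqrt_nonneg 2
  nlinarith [mul_nonneg hs0 (sq_nonneg (x - y)), mul_nonneg hs0 (sq_nonneg y), sq_nonneg (x - y),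
    sq_nonneg x, sq_nonneg y]

lemma Psi_bounds {a b c M x y : ℝ} (hM : 0 ≤ M)
    (H : ∀ u v : ℝ, 0 ≤ v → v ≤ u → |a * u ^ 2 + b * v ^ 2 + c * u * v| ≤ M * (u ^ 2 + v ^ 2))
    (hy : 0 ≤ y) (hyx : y ≤ x) (hx : 0 < x) :
    |2 * a * x + c * y| ≤ Psi x y * M ∧
      |(2 * a * x + c * y) + (2 * b * y + c * x)| ≤ √2 * (Psi x y * M) ∧
      2 * (x ^ 2 + y ^ 2) ≤ Psi x y * x ∧ 2 * √2 * (x ^ 2 + y ^ 2) ≤ Psi x y * (x + y) := by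
  have hs : √2 ^ 2 = 2 := Real.sq_sqrt (by norm_num)
  have hs0 : 0 < √2 := by positivity
  have hsl : 1.414 < √2 := Real.lt_sqrt_of_sq_lt (by norm_num)
  have hsu : √2 < 1.415 := (Real.sqrt_lt' (by norm_num)).2 (by norm_num)
  have hpart : y < x → 2 * (x ^ 2 - x * y + y ^ 2) ≤ Psi x y * (x - y) →
      |2 * a * x + c * y| ≤ Psi x y * M ∧ 2 * (x ^ 2 + y ^ 2) ≤ Psi x y * x := by
    intro hlt h
    have hd : 0 < x - y := sub_pos.2 hlt
    constructor
    · refine le_of_mul_le_mul_left ?_ hd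
      nlinarith [abs_partial_le_two_points H hy hyx, mul_le_mul_of_nonneg_right h hM]
    · refine le_of_mul_le_mul_left ?_ hd
      nlinarith [mul_le_mul_of_nonneg_right h hx.le, pow_nonneg hy 3]
  have hdiag : 0 < y → √2 * (x ^ 2 + 3 * y ^ 2) ≤ Psi x y * (2 * y) →
      |(2 * a * x + c * y) + (2 * b * y + c * x)| ≤ √2 * (Psi x y * M) ∧
        2 * √2 * (x ^ 2 + y ^ 2) ≤ Psi x y * (x + y) := by
    intro hy0 h
    constructor
    · refine le_of_mul_le_mul_left ?_ hy0
      have h' : x ^ 2 + 3 * y ^ 2 ≤ √2 * Psi x y * y := by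
        nlinarith [mul_le_mul_of_nonneg_left h hs0.le]
      nlinarith [abs_diag_le_two_points H hy hyx, mul_le_mul_of_nonneg_right h' hM]
    · refine le_of_mul_le_mul_left ?_ hy0
      nlinarith [mul_le_mul_of_nonneg_right h (add_pos hx hy0).le,
        mul_nonneg hs0.le (pow_nonneg (sub_nonneg.2 hyx) 3)]
  by_cases c1 : y < (2 * √2 - 1) / 7 * x
  · have hP : Psi x y = √2 * ((1 + 2 * √2) * x - (3 + 2 * √2) * y) := if_pos c1
    have hyl : y ≤ 0.262 * x := by nlinarith
    have h4 : 4 * y ≤ √2 * (x - y) := by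
      nlinarith [mul_lt_mul_of_pos_left c1 (by positivity : 0 < 4 + √2)]
    have hlow : 5.4 * x - 8.25 * y ≤ Psi x y := by
      have : Psi x y = √2 * (x - 3 * y) + 4 * x - 4 * y := by
        rw [hP]; linear_combination (2 * x - 2 * y) * hs
      nlinarith
    have hdg := abs_diag_le_three_points H hyx h4
    obtain ⟨p1, p2⟩ := hpart (by nlinarith) (by
      nlinarith [mul_le_mul_of_nonneg_right hlow (sub_nonneg.2 hyx)])
    refine ⟨p1, ?_, p2, ?_⟩
    · convert hdg using 1
      rw [hP]
      linear_combination ((1 + 2 * √2) * x - (3 + 2 * √2) * y) * M * hs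
    · nlinarith [mul_le_mul_of_nonneg_right hlow (add_nonneg hx.le hy),
        mul_le_mul_of_nonneg_right hsu.le (add_nonneg (sq_nonneg x) (sq_nonneg y))]
  have hy0 : 0 < y := lt_of_lt_of_le (by nlinarith) (not_lt.1 c1)
  by_cases c2 : y < (√2 - 1) * x
  · have hP : Psi x y = √2 * (x ^ 2 + 3 * y ^ 2) / (2 * y) := by
      rw [Psi, if_neg c1, if_pos c2]
    have hPy : Psi x y * (2 * y) = √2 * (x ^ 2 + 3 * y ^ 2) := by
      rw [hP]; field_simp
    obtain ⟨d1, d2⟩ := hdiag hy0 hPy.ge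
    obtain ⟨p1, p2⟩ := hpart (by nlinarith) (by
      refine le_of_mul_le_mul_left ?_ (mul_pos two_pos hy0)
      have := mul_nonneg (sub_pos.2 c2).le (middle_factor_nonneg x y)
      rw [← middle_branches_factor] at this
      linear_combination this - (x - y) * hPy)
    exact ⟨p1, d1, p2, d2⟩
  by_cases c3 : y < (2 - √2) * x
  · have hP : Psi x y = 2 * (x + y ^ 2 / (x - y)) := by
      rw [Psi, if_neg c1, if_neg c2, if_pos c3]
    have hlt : y < x := by nlinarith
    have hd : 0 < x - y := sub_pos.2 hlt
    have hPy : Psi x y * (x - y) = 2 * (x ^ 2 - x * y + y ^ 2) := by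
      rw [hP]; field_simp
    obtain ⟨p1, p2⟩ := hpart hlt hPy.ge
    obtain ⟨d1, d2⟩ := hdiag hy0 (by
      refine le_of_mul_le_mul_left ?_ hd
      have := mul_nonneg (sub_nonneg.2 (not_lt.1 c2)) (middle_factor_nonneg x y)
      have := middle_branches_factor x y
      linarith [mul_comm y (Psi x y * (x - y)), congrArg (y * ·) hPy])
    exact ⟨p1, d1, p2, d2⟩
  · have hP : Psi x y = 4 * (1 + √2) * y - 2 * x := by
      rw [Psi, if_neg c1, if_neg c2, if_neg c3]
    have c3' := not_lt.1 c3
    have hyl : 0.585 * x ≤ y := by nlinarith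
    have hlow : 9.656 * y - 2 * x ≤ Psi x y := by rw [hP]; nlinarith
    obtain ⟨d1, d2⟩ := hdiag hy0 (by
      nlinarith [mul_le_mul_of_nonneg_right hlow hy,
        mul_le_mul_of_nonneg_right hsu.le (by positivity : 0 ≤ x ^ 2 + 3 * y ^ 2)])
    refine ⟨?_, d1, ?_, d2⟩
    · rw [hP]
      refine abs_partial_le_three_points H hy ?_
      nlinarith [mul_le_mul_of_nonneg_left c3' (by positivity : 0 ≤ 2 + √2)]
    · nlinarith [mul_le_mul_of_nonneg_right hlow hx.le]

theorem stmt_6 (x y : ℝ) (hxy : (x, y) ∈ sector) (a b c : ℝ) :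
    diffNorm a b c x y ≤ Psi x y * secNorm a b c := by
  obtain ⟨hy, hyx, -⟩ := hxy
  simp only at hy hyx
  have hM := secNorm_nonneg a b c
  rcases (hy.trans hyx).eq_or_lt with hx | hx
  · obtain rfl : y = 0 := by linarith
    subst hx
    refine Real.sSup_le ?_ (by simp [Psi])
    rintro _ ⟨q, -, rfl⟩
    simp [Psi]
  have H := fun u v (hv : 0 ≤ v) (hvu : v ≤ u) => abs_le_secNorm_mul a b c hv hvu
  obtain ⟨h1, h2, h3, h4⟩ := Psi_bounds hM H hy hyx hx
  have hP : 0 ≤ Psi x y := nonneg_of_mul_nonneg_left (le_trans (by positivity) h3) hx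
  obtain ⟨he, he'⟩ := abs_le.1 (H x y hy hyx)
  refine Real.sSup_le ?_ (mul_nonneg hP hM)
  rintro _ ⟨⟨u, v⟩, ⟨hv, hvu, huv⟩, rfl⟩
  refine abs_le'.2 ⟨?_, ?_⟩
  · exact linear_le_of_extreme hx hM hP h1 h2 (by linarith) h3 h4 hv hvu huv
  · have := linear_le_of_extreme (g := -(2 * a * x + c * y)) (h := -(2 * b * y + c * x)) hx hM hP
      (by rwa [abs_neg]) (by rwa [← neg_add, abs_neg]) (by linarith) h3 h4 hv hvu huv
    simp only at this ⊢
    linarith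
end
end

section
/- For every (a,b,c) ∈ ℝ³, ‖L_{a,b,c}‖ ≤ (2 + √2/2)·‖(a,b,c)‖. Moreover equality holds for the triple (1, 5+4√2, −4−4√2): one has ‖(1, 5+4√2, −4−4√2)‖ = 1 and ‖L_{1,5+4√2,−4−4√2}‖ = 2 + √2/2. Hence the polarization constant of the space of 2-homogeneous polynomials on ℝ² with the supremum norm over D(π/4) is 2 + √2/2. -/
open Real Set

noncomputable section

/-- The sup norm over the sector squared of the polar (symmetric bilinear form) of P_{a,b,c}. -/
def polarNorm (a b c : ℝ) : ℝ :=
  sSup {r : ℝ | ∃ p ∈ sector, ∃ q ∈ sector,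
    r = |a * p.1 * q.1 + b * p.2 * q.2 + c / 2 * (p.1 * q.2 + p.2 * q.1)|}

lemma zero_mem_sector : ((0, 0) : ℝ × ℝ) ∈ sector := by simp [sector]

lemma one_zero_mem_sector : ((1, 0) : ℝ × ℝ) ∈ sector := by simp [sector]

lemma diag_mem_sector : ((√2 / 2, √2 / 2) : ℝ × ℝ) ∈ sector := by
  have h : √2 ^ 2 = 2 := Real.sq_sqrt (by norm_num)
  exact ⟨by positivity, le_rfl, by simp only; nlinarith⟩

lemma cos_pi_div_eight_sq : cos (π / 8) ^ 2 = (2 + √2) / 4 := by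
  rw [Real.cos_sq, show 2 * (π / 8) = π / 4 by ring, Real.cos_pi_div_four]
  ring

lemma sin_pi_div_eight_sq : sin (π / 8) ^ 2 = (2 - √2) / 4 := by
  linarith [Real.sin_sq_add_cos_sq (π / 8), cos_pi_div_eight_sq]

lemma cos_mul_sin_pi_div_eight : cos (π / 8) * sin (π / 8) = √2 / 4 := by
  have h := Real.sin_two_mul (π / 8)
  rw [show 2 * (π / 8) = π / 4 by ring, Real.sin_pi_div_four] at h
  linarith

lemma cos_sin_pi_div_eight_mem_sector : (cos (π / 8), sin (π / 8)) ∈ sector := by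
  have hc : 0 ≤ cos (π / 8) :=
    Real.cos_nonneg_of_mem_Icc ⟨by linarith [Real.pi_pos], by linarith [Real.pi_pos]⟩
  have hs : 0 ≤ sin (π / 8) :=
    Real.sin_nonneg_of_nonneg_of_le_pi (by positivity) (by linarith [Real.pi_pos])
  refine ⟨hs, ?_, (Real.cos_sq_add_sin_sq _).le⟩
  refine (sq_le_sq₀ hs hc).1 ?_
  rw [cos_pi_div_eight_sq, sin_pi_div_eight_sq]
  linarith [Real.sqrt_nonneg 2]

/-- Elementary bounds for the products of coordinates of two points of the sector. -/
lemma sector_products {p q : ℝ × ℝ} (hp : p ∈ sector) (hq : q ∈ sector) :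
    0 ≤ p.2 * q.2 ∧ p.2 * q.2 ≤ p.1 * q.2 ∧ p.2 * q.2 ≤ p.2 * q.1 ∧
    p.1 * q.2 ≤ p.1 * q.1 ∧ p.2 * q.1 ≤ p.1 * q.1 ∧
    p.1 * q.1 + p.2 * q.2 ≤ 1 ∧ p.1 * q.2 + p.2 * q.1 ≤ 1 := by
  obtain ⟨x, y⟩ := p
  obtain ⟨u, v⟩ := q
  obtain ⟨hy, hyx, hxy⟩ := hp
  obtain ⟨hv, hvu, huv⟩ := hq
  simp only at *
  have hx := hy.trans hyx
  have hu := hv.trans hvu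
  refine ⟨by positivity, by gcongr, by gcongr, by gcongr, by gcongr, ?_, ?_⟩
  · nlinarith [sq_nonneg (x - u), sq_nonneg (y - v)]
  · nlinarith [sq_nonneg (x - v), sq_nonneg (y - u)]

lemma abs_le_secNorm (a b c : ℝ) {p : ℝ × ℝ} (hp : p ∈ sector) :
    |a * p.1 ^ 2 + b * p.2 ^ 2 + c * p.1 * p.2| ≤ secNorm a b c := by
  refine le_csSup ⟨|a| + |b| + |c|, ?_⟩ ⟨p, hp, rfl⟩
  rintro _ ⟨q, hq, rfl⟩
  obtain ⟨h1, h2, h3, h4, h5, h6, h7⟩ := sector_products hq hq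
  simp only
  calc _ ≤ |a * q.1 ^ 2| + |b * q.2 ^ 2| + |c * q.1 * q.2| := abs_add_three _ _ _
    _ = |a| * q.1 ^ 2 + |b| * q.2 ^ 2 + |c| * (q.1 * q.2) := by
      rw [mul_assoc c, abs_mul, abs_mul, abs_mul c, abs_sq, abs_sq,
        abs_of_nonneg (h1.trans h2)]
    _ ≤ |a| * 1 + |b| * 1 + |c| * 1 := by gcongr <;> nlinarith
    _ = _ := by ring

/-- The polar of the extremal polynomial is bounded below by `-(2 + √2 / 2)`. -/
lemma extremal_polar_bound {p q : ℝ × ℝ} (hp : p ∈ sector) (hq : q ∈ sector) :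
    (2 + 2 * √2) * (p.1 * q.2 + p.2 * q.1) - (5 + 4 * √2) * (p.2 * q.2) - p.1 * q.1
      ≤ 2 + √2 / 2 := by
  obtain ⟨h1, h2, h3, h4, h5, -, -⟩ := sector_products hp hq
  have hs : √2 ^ 2 = 2 := Real.sq_sqrt (by norm_num)
  have hs0 : 0 < √2 := by positivity
  obtain ⟨x, y⟩ := p
  obtain ⟨u, v⟩ := q
  simp only at *
  set N := √((x ^ 2 + y ^ 2) * (u ^ 2 + v ^ 2)) with hN
  have hNsq : N ^ 2 = (x ^ 2 + y ^ 2) * (u ^ 2 + v ^ 2) := Real.sq_sqrt (by positivity)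
  have hN0 : 0 ≤ N := Real.sqrt_nonneg _
  have hN1 : N ≤ 1 := by
    rw [hN, Real.sqrt_le_one]
    exact mul_le_one₀ hp.2.2 (by positivity) hq.2.2
  have hlow : √2 / 2 * N ≤ x * u + y * v := by
    refine abs_le_of_sq_le_sq' ?_ (by linarith) |>.2
    have : (x * v - y * u) ^ 2 ≤ (x * u + y * v) ^ 2 :=
      sq_le_sq' (by linarith) (by linarith)
    rw [mul_pow, div_pow, hs, hNsq]
    nlinarith
  have hup : (x * u - y * v) + (x * v + y * u) ≤ √2 * N := by
    refine abs_le_of_sq_le_sq' ?_ (by positivity) |>.2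
    rw [mul_pow, hs, hNsq]
    nlinarith [sq_nonneg ((x * u - y * v) - (x * v + y * u))]
  have e1 := mul_le_mul_of_nonneg_left hup (by positivity : 0 ≤ 2 + 2 * √2)
  have e2 := mul_le_mul_of_nonneg_left hlow (by positivity : 0 ≤ 3 + 2 * √2)
  have e3 := mul_le_mul_of_nonneg_left hN1 (by positivity : 0 ≤ 2 + √2 / 2)
  have e4 : (2 + 2 * √2) * (√2 * N) - (3 + 2 * √2) * (√2 / 2 * N) = (2 + √2 / 2) * N := by
    linear_combination N * hs
  linarith

/-- The polar at two points of the sector, expressed through the values of the polynomial at the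
angles `0`, `π / 8` and `π / 4`, has coefficients with absolute sum at most `2 + √2 / 2`. -/
lemma interpolation_coeff_bound {p q : ℝ × ℝ} (hp : p ∈ sector) (hq : q ∈ sector) {w : ℝ}
    (hw : w = (p.1 * q.2 + p.2 * q.1) / 2 - p.2 * q.2) :
    |p.1 * q.1 - p.2 * q.2 - (2 + √2) * w| + |(2 + 2 * √2) * w| + |2 * (p.2 * q.2) - √2 * w|
      ≤ 2 + √2 / 2 := by
  have hext := extremal_polar_bound hp hq
  obtain ⟨h1, h2, h3, h4, h5, h6, h7⟩ := sector_products hp hq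
  have h8 : 0 ≤ (p.1 - p.2) * (q.1 - q.2) :=
    mul_nonneg (sub_nonneg.2 hp.2.1) (sub_nonneg.2 hq.2.1)
  have hs0 : 0 ≤ √2 := Real.sqrt_nonneg 2
  have hs2 : √2 ≤ 3 / 2 := Real.sqrt_le_iff.2 (by norm_num)
  have hw0 : 0 ≤ w := by linarith
  have hwle : 2 * w ≤ 1 - 2 * (p.2 * q.2) := by linarith
  rw [abs_of_nonneg (by positivity : 0 ≤ (2 + 2 * √2) * w)]
  have m1 := mul_le_mul_of_nonneg_left hwle hs0
  have m2 := mul_nonneg hs0 h1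
  rcases abs_cases (p.1 * q.1 - p.2 * q.2 - (2 + √2) * w) with ⟨e, -⟩ | ⟨e, -⟩ <;>
  rcases abs_cases (2 * (p.2 * q.2) - √2 * w) with ⟨e', -⟩ | ⟨e', -⟩ <;>
  rw [e, e']
  · linarith
  · linarith
  · subst hw; linarith
  · subst hw; linarith

lemma abs_polar_le (a b c : ℝ) {p q : ℝ × ℝ} (hp : p ∈ sector) (hq : q ∈ sector) :
    |a * p.1 * q.1 + b * p.2 * q.2 + c / 2 * (p.1 * q.2 + p.2 * q.1)|
      ≤ (2 + √2 / 2) * secNorm a b c := by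
  have hs : √2 ^ 2 = 2 := Real.sq_sqrt (by norm_num)
  have hA := abs_le_secNorm a b c one_zero_mem_sector
  have hB := abs_le_secNorm a b c cos_sin_pi_div_eight_mem_sector
  have hC := abs_le_secNorm a b c diag_mem_sector
  simp only [mul_assoc c, cos_pi_div_eight_sq, sin_pi_div_eight_sq,
    cos_mul_sin_pi_div_eight] at hA hB hC
  set M := secNorm a b c
  have hM : 0 ≤ M := (abs_nonneg _).trans hA
  obtain ⟨w, hw⟩ : ∃ w, w = (p.1 * q.2 + p.2 * q.1) / 2 - p.2 * q.2 := ⟨_, rfl⟩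
  have hK := interpolation_coeff_bound hp hq hw
  set A := a * 1 ^ 2 + b * 0 ^ 2 + c * (1 * 0) with hAdef
  set B := a * ((2 + √2) / 4) + b * ((2 - √2) / 4) + c * (√2 / 4) with hBdef
  set C := a * (√2 / 2) ^ 2 + b * (√2 / 2) ^ 2 + c * (√2 / 2 * (√2 / 2)) with hCdef
  have key : a * p.1 * q.1 + b * p.2 * q.2 + c / 2 * (p.1 * q.2 + p.2 * q.1) =
      (p.1 * q.1 - p.2 * q.2 - (2 + √2) * w) * A + (2 + 2 * √2) * w * B +
        (2 * (p.2 * q.2) - √2 * w) * C := by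
    rw [hAdef, hBdef, hCdef, hw]
    linear_combination (-((p.1 * q.2 + p.2 * q.1) / 2 - p.2 * q.2) / 2 * (a - b + c) -
      (2 * (p.2 * q.2) - √2 * ((p.1 * q.2 + p.2 * q.1) / 2 - p.2 * q.2)) * (a + b + c) / 4) * hs
  rw [key]
  refine (abs_add_three _ _ _).trans ?_
  rw [abs_mul, abs_mul (_ * w), abs_mul _ C]
  calc _ ≤ |p.1 * q.1 - p.2 * q.2 - (2 + √2) * w| * M + |(2 + 2 * √2) * w| * M +
        |2 * (p.2 * q.2) - √2 * w| * M := by gcongr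
    _ = (|p.1 * q.1 - p.2 * q.2 - (2 + √2) * w| + |(2 + 2 * √2) * w| +
        |2 * (p.2 * q.2) - √2 * w|) * M := by ring
    _ ≤ _ := by gcongr

lemma polarNorm_le (a b c : ℝ) : polarNorm a b c ≤ (2 + √2 / 2) * secNorm a b c := by
  refine csSup_le ⟨_, _, zero_mem_sector, _, zero_mem_sector, rfl⟩ ?_
  rintro _ ⟨p, hp, q, hq, rfl⟩
  exact abs_polar_le a b c hp hq

lemma le_polarNorm (a b c : ℝ) {p q : ℝ × ℝ} (hp : p ∈ sector) (hq : q ∈ sector) :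
    |a * p.1 * q.1 + b * p.2 * q.2 + c / 2 * (p.1 * q.2 + p.2 * q.1)| ≤ polarNorm a b c := by
  refine le_csSup ⟨(2 + √2 / 2) * secNorm a b c, ?_⟩ ⟨p, hp, q, hq, rfl⟩
  rintro _ ⟨p, hp, q, hq, rfl⟩
  exact abs_polar_le a b c hp hq

lemma secNorm_extremal : secNorm 1 (5 + 4 * √2) (-4 - 4 * √2) = 1 := by
  have hs : √2 ^ 2 = 2 := Real.sq_sqrt (by norm_num)
  have hs0 : 0 < √2 := by positivity
  refine le_antisymm (csSup_le ⟨_, _, zero_mem_sector, rfl⟩ ?_) ?_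
  · rintro _ ⟨⟨x, y⟩, hp, rfl⟩
    obtain ⟨hy, hyx, hxy⟩ := hp
    simp only at *
    rw [abs_le]
    constructor
    · have : 1 * x ^ 2 + (5 + 4 * √2) * y ^ 2 + (-4 - 4 * √2) * x * y + (x ^ 2 + y ^ 2) =
          2 * (x - (1 + √2) * y) ^ 2 := by
        linear_combination (-2 * y ^ 2) * hs
      nlinarith [sq_nonneg (x - (1 + √2) * y)]
    · nlinarith [mul_nonneg hy (sub_nonneg.2 hyx),
        mul_nonneg hs0.le (mul_nonneg hy (sub_nonneg.2 hyx))]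
  · simpa using abs_le_secNorm 1 (5 + 4 * √2) (-4 - 4 * √2) one_zero_mem_sector

lemma polarNorm_extremal :
    polarNorm 1 (5 + 4 * √2) (-4 - 4 * √2) = 2 + √2 / 2 := by
  have hs : √2 ^ 2 = 2 := Real.sq_sqrt (by norm_num)
  refine le_antisymm ?_ ?_
  · simpa [secNorm_extremal] using polarNorm_le 1 (5 + 4 * √2) (-4 - 4 * √2)
  · refine le_trans ?_
      (le_polarNorm 1 (5 + 4 * √2) (-4 - 4 * √2) one_zero_mem_sector diag_mem_sector)
    refine le_trans (le_of_eq ?_) (neg_le_abs _)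
    linear_combination (-1 : ℝ) * hs

theorem stmt_9 :
    (∀ a b c : ℝ, polarNorm a b c ≤ (2 + Real.sqrt 2 / 2) * secNorm a b c) ∧
    secNorm 1 (5 + 4 * Real.sqrt 2) (-4 - 4 * Real.sqrt 2) = 1 ∧
    polarNorm 1 (5 + 4 * Real.sqrt 2) (-4 - 4 * Real.sqrt 2) = 2 + Real.sqrt 2 / 2 ∧
    IsLeast {K : ℝ | ∀ a b c : ℝ, polarNorm a b c ≤ K * secNorm a b c}
      (2 + Real.sqrt 2 / 2) := by
  refine ⟨polarNorm_le, secNorm_extremal, polarNorm_extremal, polarNorm_le, fun K hK => ?_⟩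
  simpa [secNorm_extremal, polarNorm_extremal] using hK 1 (5 + 4 * √2) (-4 - 4 * √2)
end
end
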